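/- arXiv:1810.05250 — 2 statements merged into one kernel-verified Lean document; each statement's English description precedes it below -/
import Mathlib

section
/- Let 𝒳 be a nonempty finite alphabet and for each i ∈ ℕ let p̂^(c)_i, p̂^(r)_i, p*^(c)_i, p*^(r)_i be strictly positive probability mass functions on 𝒳. Suppose there exist functions M_c, M_r : ℕ → ℝ with M_c(n) ≥ 1 for all n, such that for every n: ∑_{i=1}^n D(p*^(c)_i ‖ p̂^(c)_i) ≤ M_c(n) and ∑_{i=1}^n | E_{p*^(c)_i}[ log( p*^(r)_i(X) / p̂^(r)_i(X) ) ] | ≤ M_r(n). Suppose further there exists L ∈ ℝ such that | log( p̂^(c)_i(x) / p̂^(r)_i(x) ) | ≤ L for every i and every x ∈ 𝒳, and that M_c(n)/n → 0 and M_r(n)/n → 0 as n → ∞. Then the normalized causality regret tends to zero: (1/n) · ∑_{i=1}^n | D(p̂^(c)_i ‖ p̂^(r)_i) − D(p*^(c)_i ‖ p*^(r)_i) | → 0 as n → ∞. -/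
open Finset
open scoped Classical

noncomputable section

/-- Probability of the event `A` under the pmf `P` on a finite sample space. -/
def prob {Ω : Type*} [Fintype Ω] (P : Ω → ℝ) (A : Ω → Prop) : ℝ :=
  ∑ ω, if A ω then P ω else 0

/-- Conditional probability of `A` given `B` (with the junk value `0` when `B` has
probability zero, via division by zero). -/
def cprob {Ω : Type*} [Fintype Ω] (P : Ω → ℝ) (A B : Ω → Prop) : ℝ :=
  prob P (fun ω => A ω ∧ B ω) / prob P B

/-- Kullback–Leibler divergence (base 2) between pmfs on a finite alphabet, with the
convention `0 * log (0 / q) = 0` (automatic since `Real.log 0 = 0`). -/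
def kl {α : Type*} [Fintype α] (p q : α → ℝ) : ℝ :=
  ∑ x, p x * Real.logb 2 (p x / q x)

/-- The event that the process `X` agrees with its realization at `ω` on all indices `j`
with `1 ≤ j`, `a ≤ j` and `j ≤ b` (processes are indexed starting at time 1). -/
def hist {Ω α : Type*} (X : ℕ → Ω → α) (a b : ℕ) (ω : Ω) : Ω → Prop :=
  fun ω' => ∀ j, 1 ≤ j → a ≤ j → j ≤ b → X j ω' = X j ω

/-- Conditional Shannon entropy (base 2) of `U` given the conditioning family of events `E`
(`E ω` is the conditioning event realized at sample point `ω`). -/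
def condEntB {Ω α : Type*} [Fintype Ω] (P : Ω → ℝ) (U : Ω → α) (E : Ω → Ω → Prop) : ℝ :=
  -(∑ ω, P ω * Real.logb 2 (cprob P (fun ω' => U ω' = U ω) (E ω)))

/-- Binary KL divergence (base 2) between Bernoulli parameters `a` and `b`. -/
def dBin (a b : ℝ) : ℝ :=
  a * Real.logb 2 (a / b) + (1 - a) * Real.logb 2 ((1 - a) / (1 - b))

/-- Pointwise Hellinger-type lower bound on the unnormalized divergence integrand. -/
theorem sq_sqrt_sub_sqrt_le {a b : ℝ} (ha : 0 < a) (hb : 0 < b) :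
    (√a - √b) ^ 2 ≤ a * Real.log (a / b) - a + b := by
  have hsa := Real.sqrt_pos.2 ha
  have hsb := Real.sqrt_pos.2 hb
  have h := Real.log_le_sub_one_of_pos (div_pos hsb hsa)
  rw [Real.log_div hsb.ne' hsa.ne', Real.log_sqrt hb.le, Real.log_sqrt ha.le] at h
  rw [Real.log_div ha.ne' hb.ne']
  have h2 : a * (√b / √a) = √a * √b := by
    nth_rewrite 1 [← Real.mul_self_sqrt ha.le]
    field_simp
  have h3 := mul_le_mul_of_nonneg_left h ha.le
  nlinarith [Real.sq_sqrt ha.le, Real.sq_sqrt hb.le]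

theorem abs_sub_le_div_add_mul {a b ε : ℝ} (ha : 0 < a) (hb : 0 < b) (hε : 0 < ε) :
    |a - b| ≤ (a * Real.log (a / b) - a + b) / (2 * ε) + ε * (a + b) := by
  have hsa := Real.sqrt_nonneg a
  have hsb := Real.sqrt_nonneg b
  have h1 : |a - b| = |√a - √b| * (√a + √b) := by
    rw [← abs_of_nonneg (add_nonneg hsa hsb), ← abs_mul]
    congr 1
    nlinarith [Real.sq_sqrt ha.le, Real.sq_sqrt hb.le]
  have h2 : |√a - √b| * (√a + √b) ≤ (√a - √b) ^ 2 / (2 * ε) + ε * (a + b) := by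
    have h3 : (√a + √b) ^ 2 ≤ 2 * (a + b) := by
      nlinarith [Real.sq_sqrt ha.le, Real.sq_sqrt hb.le, sq_nonneg (√a - √b)]
    have h4 := sq_nonneg (|√a - √b| - ε * (√a + √b))
    rw [← sub_le_iff_le_add, le_div_iff₀ (by positivity), ← sq_abs (√a - √b)]
    nlinarith [mul_le_mul_of_nonneg_left h3 (sq_nonneg ε)]
  rw [h1]
  refine h2.trans ?_
  gcongr
  exact sq_sqrt_sub_sqrt_le ha hb

theorem log_two_mul_kl {α : Type*} [Fintype α] (p q : α → ℝ) :
    Real.log 2 * kl p q = ∑ x, p x * Real.log (p x / q x) := by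
  have : Real.log 2 ≠ 0 := (Real.log_pos one_lt_two).ne'
  simp only [kl, Finset.mul_sum, Real.logb]
  refine Finset.sum_congr rfl fun x _ => ?_
  field_simp

theorem kl_nonneg_of_pos {α : Type*} [Fintype α] {p q : α → ℝ} (hp : ∀ x, 0 < p x)
    (hq : ∀ x, 0 < q x) (hp1 : ∑ x, p x = 1) (hq1 : ∑ x, q x = 1) : 0 ≤ kl p q := by
  have h : 0 ≤ ∑ x, (p x * Real.log (p x / q x) - p x + q x) :=
    Finset.sum_nonneg fun x _ => (sq_nonneg _).trans (sq_sqrt_sub_sqrt_le (hp x) (hq x))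
  rw [Finset.sum_add_distrib, Finset.sum_sub_distrib, hp1, hq1, ← log_two_mul_kl] at h
  exact nonneg_of_mul_nonneg_right (by linarith) (Real.log_pos one_lt_two)

/-- A linearized, non-sharp form of Pinsker's inequality. -/
theorem sum_abs_sub_le_kl {α : Type*} [Fintype α] {p q : α → ℝ} (hp : ∀ x, 0 < p x)
    (hq : ∀ x, 0 < q x) (hp1 : ∑ x, p x = 1) (hq1 : ∑ x, q x = 1) {ε : ℝ} (hε : 0 < ε) :
    ∑ x, |p x - q x| ≤ kl p q / (2 * ε) + 2 * ε := by
  have h := Finset.sum_le_sum fun x (_ : x ∈ Finset.univ) =>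
    abs_sub_le_div_add_mul (hp x) (hq x) hε
  rw [Finset.sum_add_distrib, ← Finset.sum_div, ← Finset.mul_sum, Finset.sum_add_distrib,
    Finset.sum_add_distrib, Finset.sum_sub_distrib, hp1, hq1, ← log_two_mul_kl,
    sub_add_cancel, one_add_one_eq_two, mul_comm ε] at h
  have hk : Real.log 2 * kl p q ≤ kl p q :=
    mul_le_of_le_one_left (kl_nonneg_of_pos hp hq hp1 hq1) (by linarith [Real.log_two_lt_d9])
  calc ∑ x, |p x - q x| ≤ Real.log 2 * kl p q / (2 * ε) + 2 * ε := h
    _ ≤ kl p q / (2 * ε) + 2 * ε := by gcongr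

theorem kl_sub_kl_eq {α : Type*} [Fintype α] {p q p' q' : α → ℝ} (hp : ∀ x, 0 < p x)
    (hq : ∀ x, 0 < q x) (hp' : ∀ x, 0 < p' x) (hq' : ∀ x, 0 < q' x) :
    kl p q - kl p' q' = ∑ x, (p x - p' x) * Real.logb 2 (p x / q x) - kl p' p +
      ∑ x, p' x * Real.logb 2 (q' x / q x) := by
  simp only [kl, ← Finset.sum_sub_distrib, ← Finset.sum_add_distrib]
  refine Finset.sum_congr rfl fun x _ => ?_
  rw [Real.logb_div (hp x).ne' (hq x).ne', Real.logb_div (hp' x).ne' (hq' x).ne',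
    Real.logb_div (hp' x).ne' (hp x).ne', Real.logb_div (hq' x).ne' (hq x).ne']
  ring

theorem abs_kl_sub_kl_le {α : Type*} [Fintype α] {p q p' q' : α → ℝ} (hp : ∀ x, 0 < p x)
    (hq : ∀ x, 0 < q x) (hp' : ∀ x, 0 < p' x) (hq' : ∀ x, 0 < q' x)
    (hp1 : ∑ x, p x = 1) (hp1' : ∑ x, p' x = 1) {L ε : ℝ} (hL0 : 0 ≤ L)
    (hL : ∀ x, |Real.logb 2 (p x / q x)| ≤ L) (hε : 0 < ε) :
    |kl p q - kl p' q'| ≤ L * (kl p' p / (2 * ε) + 2 * ε) + kl p' p +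
      |∑ x, p' x * Real.logb 2 (q' x / q x)| := by
  have h1 : |∑ x, (p x - p' x) * Real.logb 2 (p x / q x)| ≤
      L * (kl p' p / (2 * ε) + 2 * ε) := by
    calc |∑ x, (p x - p' x) * Real.logb 2 (p x / q x)|
        ≤ ∑ x, |(p x - p' x) * Real.logb 2 (p x / q x)| := Finset.abs_sum_le_sum_abs _ _
      _ ≤ ∑ x, L * |p' x - p x| := by
          refine Finset.sum_le_sum fun x _ => ?_
          rw [abs_mul, abs_sub_comm, mul_comm]
          gcongr
          exact hL x
      _ ≤ L * (kl p' p / (2 * ε) + 2 * ε) := by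
          rw [← Finset.mul_sum]
          gcongr
          exact sum_abs_sub_le_kl hp' hp hp1' hp1 hε
  rw [kl_sub_kl_eq hp hq hp' hq']
  refine (abs_add_le _ _).trans (add_le_add_left ((abs_sub _ _).trans ?_) _)
  rw [abs_of_nonneg (kl_nonneg_of_pos hp' hp hp1' hp1)]
  exact add_le_add_left h1 _

/-- If the regret bounds `Mc`, `Mr` are sublinear (`Mc n / n → 0`, `Mr n / n → 0`,
with `Mc n ≥ 1`), the per-step KL and expected-regret hypotheses hold for every `n`, and the
log ratio of the complete and restricted predictors is uniformly bounded by `L`, then the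
normalized causality regret tends to zero. -/
theorem causality_regret_sublinear
    {𝒳 : Type*} [Fintype 𝒳] [Nonempty 𝒳]
    (pcHat prHat pcStar prStar : ℕ → 𝒳 → ℝ)
    (hpcHat : ∀ i x, 0 < pcHat i x) (hpcHatSum : ∀ i, ∑ x, pcHat i x = 1)
    (hprHat : ∀ i x, 0 < prHat i x) (hprHatSum : ∀ i, ∑ x, prHat i x = 1)
    (hpcStar : ∀ i x, 0 < pcStar i x) (hpcStarSum : ∀ i, ∑ x, pcStar i x = 1)
    (hprStar : ∀ i x, 0 < prStar i x) (hprStarSum : ∀ i, ∑ x, prStar i x = 1)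
    (Mc Mr : ℕ → ℝ) (hMc1 : ∀ n, 1 ≤ Mc n)
    (hKLc : ∀ n, ∑ i ∈ Finset.Icc 1 n, kl (pcStar i) (pcHat i) ≤ Mc n)
    (hRefr : ∀ n, ∑ i ∈ Finset.Icc 1 n,
        |∑ x, pcStar i x * Real.logb 2 (prStar i x / prHat i x)| ≤ Mr n)
    (L : ℝ) (hL : ∀ i x, |Real.logb 2 (pcHat i x / prHat i x)| ≤ L)
    (hMc0 : Filter.Tendsto (fun n : ℕ => Mc n / n) Filter.atTop (nhds 0))
    (hMr0 : Filter.Tendsto (fun n : ℕ => Mr n / n) Filter.atTop (nhds 0)) :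
    Filter.Tendsto
      (fun n : ℕ => (1 / (n : ℝ)) *
        ∑ i ∈ Finset.Icc 1 n, |kl (pcHat i) (prHat i) - kl (pcStar i) (prStar i)|)
      Filter.atTop (nhds 0) := by
  have hL0 : 0 ≤ L := (abs_nonneg _).trans (hL 0 (Classical.arbitrary 𝒳))
  have hlim : Filter.Tendsto (fun n : ℕ => L * (5 / 2 * √(Mc n / n)) + Mc n / n + Mr n / n)
      Filter.atTop (nhds 0) := by
    simpa using (((hMc0.sqrt.const_mul (5 / 2)).const_mul L).add hMc0).add hMr0
  refine squeeze_zero' (Filter.Eventually.of_forall fun n => by positivity) ?_ hlim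
  filter_upwards [Filter.eventually_gt_atTop 0] with n hn
  have hn' : (0 : ℝ) < n := Nat.cast_pos.2 hn
  have hr : 0 < Mc n / n := div_pos (zero_lt_one.trans_le (hMc1 n)) hn'
  set ε := √(Mc n / n) with hεdef
  have hε : 0 < ε := Real.sqrt_pos.2 hr
  have hεsq : Mc n = n * ε ^ 2 := by
    rw [hεdef, Real.sq_sqrt hr.le]
    field_simp
  have hsum := Finset.sum_le_sum fun i (_ : i ∈ Finset.Icc 1 n) =>
    abs_kl_sub_kl_le (hpcHat i) (hprHat i) (hpcStar i) (hprStar i) (hpcHatSum i) (hpcStarSum i)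
      hL0 (hL i) hε
  rw [Finset.sum_add_distrib, Finset.sum_add_distrib, ← Finset.mul_sum, Finset.sum_add_distrib,
    ← Finset.sum_div, Finset.sum_const, Nat.card_Icc, Nat.add_sub_cancel, nsmul_eq_mul] at hsum
  have hbound : L * ((∑ i ∈ Finset.Icc 1 n, kl (pcStar i) (pcHat i)) / (2 * ε) + n * (2 * ε)) ≤
      L * (Mc n / (2 * ε) + n * (2 * ε)) := by
    gcongr
    exact hKLc n
  have heq : Mc n / (2 * ε) + n * (2 * ε) = n * (5 / 2 * ε) := by
    rw [hεsq]
    field_simp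
    ring
  rw [heq] at hbound
  calc _ ≤ 1 / (n : ℝ) * (L * (n * (5 / 2 * ε)) + Mc n + Mr n) := by
        gcongr
        exact hsum.trans (add_le_add (add_le_add hbound (hKLc n)) (hRefr n))
    _ = L * (5 / 2 * ε) + Mc n / n + Mr n / n := by
        field_simp

end
end

section
/- Recursive computation of the restricted distribution (generalized HMM filter): let (X, Y) be finite-alphabet random processes that are jointly first-order Markov with no instantaneous influences (X_i and Y_i are conditionally independent given (X^{i-1}, Y^{i-1})). Then for every i ≥ 2 and every positive-probability history y^i: (a) the one-step 'likelihood' decomposition holds: P(Y_{i+1} = y ∣ Y^i = y^i) = ∑_{x} P(Y_{i+1} = y ∣ X_i = x, Y_i = y_i) · P(X_i = x ∣ Y^i = y^i); (b) the 'prior' decomposition holds: P(X_i = x ∣ Y^i = y^i) = ∑_{x'} P(X_i = x ∣ X_{i-1} = x', Y_{i-1} = y_{i-1}) · P(X_{i-1} = x' ∣ Y^i = y^i); and (c) the Bayes posterior update holds: P(X_{i-1} = x ∣ Y^i = y^i) = P(Y_i = y_i ∣ X_{i-1} = x, Y_{i-1} = y_{i-1}) · P(X_{i-1} = x ∣ Y^{i-1}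 = y^{i-1}) / ∑_{x'} P(Y_i = y_i ∣ X_{i-1} = x', Y_{i-1} = y_{i-1}) · P(X_{i-1} = x' ∣ Y^{i-1} = y^{i-1}). -/
open Finset
open scoped Classical

noncomputable section

section FiniteProbability

variable {Ω : Type*} [Fintype Ω] {P : Ω → ℝ}

theorem prob_nonneg (hP : ∀ ω, 0 ≤ P ω) (A : Ω → Prop) : 0 ≤ prob P A :=
  Finset.sum_nonneg fun ω _ => by split_ifs <;> simp [hP]

theorem prob_mono (hP : ∀ ω, 0 ≤ P ω) {A B : Ω → Prop} (h : ∀ ω, A ω → B ω) :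
    prob P A ≤ prob P B := by
  refine Finset.sum_le_sum fun ω _ => ?_
  by_cases hA : A ω
  · simp [hA, h ω hA]
  · simp only [hA, if_false]
    split_ifs <;> simp [hP]

theorem prob_eq_zero_of_imp (hP : ∀ ω, 0 ≤ P ω) {A B : Ω → Prop} (h : ∀ ω, A ω → B ω)
    (hB : prob P B = 0) : prob P A = 0 :=
  le_antisymm (hB ▸ prob_mono hP h) (prob_nonneg hP A)

theorem prob_congr {A B : Ω → Prop} (h : ∀ ω, A ω ↔ B ω) : prob P A = prob P B :=
  congrArg (prob P) (funext fun ω => propext (h ω))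

/-- Law of total probability over the values of a random variable on a finite sample space. -/
theorem prob_eq_sum_image {β : Type*} (f : Ω → β) (A : Ω → Prop) :
    prob P A = ∑ c ∈ univ.image f, prob P (fun ω => A ω ∧ f ω = c) := by
  unfold prob
  rw [Finset.sum_comm]
  refine Finset.sum_congr rfl fun ω _ => ?_
  by_cases hA : A ω <;> simp [hA]

theorem prob_eq_sum {β : Type*} [Fintype β] (f : Ω → β) (A : Ω → Prop) :
    prob P A = ∑ c, prob P (fun ω => f ω = c ∧ A ω) := by
  unfold prob
  rw [Finset.sum_comm]
  refine Finset.sum_congr rfl fun ω _ => ?_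
  by_cases hA : A ω <;> simp [hA]

theorem cprob_eq_sum {β : Type*} [Fintype β] (f : Ω → β) (A B : Ω → Prop) :
    cprob P A B = ∑ c, cprob P (fun ω => f ω = c ∧ A ω) B := by
  unfold cprob
  rw [prob_eq_sum f, Finset.sum_div]
  refine Finset.sum_congr rfl fun c _ => ?_
  rw [prob_congr fun ω => (and_assoc (a := f ω = c) (b := A ω) (c := B ω)).symm]

theorem cprob_mul_prob (hP : ∀ ω, 0 ≤ P ω) (A B : Ω → Prop) :
    cprob P A B * prob P B = prob P (fun ω => A ω ∧ B ω) := by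
  by_cases hB : prob P B = 0
  · rw [hB, mul_zero, prob_eq_zero_of_imp hP (fun ω h => h.2) hB]
  · exact div_mul_cancel₀ _ hB

/-- If the conditional probability of `A` given `f` is the constant `k` on an `f`-measurable
event `C`, then it is also `k` given `C`. -/
theorem prob_and_eq_mul_of_fibers {β : Type*} (f : Ω → β) {A C : Ω → Prop} {k : ℝ}
    (hC : ∀ ω ω', f ω' = f ω → C ω → C ω')
    (h : ∀ ω, C ω →
      prob P (fun ω' => A ω' ∧ f ω' = f ω) = k * prob P (fun ω' => f ω' = f ω)) :
    prob P (fun ω => A ω ∧ C ω) = k * prob P C := by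
  rw [prob_eq_sum_image f, prob_eq_sum_image f C, Finset.mul_sum]
  refine Finset.sum_congr rfl fun c hc => ?_
  obtain ⟨ω, -, rfl⟩ := Finset.mem_image.1 hc
  by_cases hω : C ω
  · rw [prob_congr (B := fun ω' => A ω' ∧ f ω' = f ω)
        fun ω' => ⟨fun h => ⟨h.1.1, h.2⟩, fun h => ⟨⟨h.1, hC ω ω' h.2 hω⟩, h.2⟩⟩,
      prob_congr (A := fun ω' => C ω' ∧ f ω' = f ω) (B := fun ω' => f ω' = f ω)
        fun ω' => ⟨fun h => h.2, fun h => ⟨hC ω ω' h hω, h⟩⟩]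
    exact h ω hω
  · have hn : ∀ ω', f ω' = f ω → ¬ C ω' := fun ω' e h => hω (hC ω' ω e.symm h)
    have h1 : prob P (fun ω' => (A ω' ∧ C ω') ∧ f ω' = f ω) = 0 :=
      Finset.sum_eq_zero fun ω' _ => if_neg fun h => hn ω' h.2 h.1.2
    have h2 : prob P (fun ω' => C ω' ∧ f ω' = f ω) = 0 :=
      Finset.sum_eq_zero fun ω' _ => if_neg fun h => hn ω' h.2 h.1
    rw [h1, h2, mul_zero]

/-- Averaging a conditional probability over the values of `U`, when the conditional
probability given `U = u` and `H` is `k u`. -/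
theorem cprob_eq_sum_mul_cprob {β : Type*} [Fintype β] (U : Ω → β) {A H : Ω → Prop} {k : β → ℝ}
    (h : ∀ u, prob P (fun ω => A ω ∧ U ω = u ∧ H ω) = k u * prob P (fun ω => U ω = u ∧ H ω)) :
    cprob P A H = ∑ u, k u * cprob P (fun ω => U ω = u) H := by
  unfold cprob
  rw [prob_eq_sum U, Finset.sum_div]
  refine Finset.sum_congr rfl fun u _ => ?_
  rw [← mul_div_assoc, ← h u, prob_congr fun ω => and_left_comm]

end FiniteProbability

theorem hist_one_iff {Ω α : Type*} (X : ℕ → Ω → α) (n : ℕ) (ω ω' : Ω) :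
    hist X 1 n ω ω' ↔ ∀ j, 1 ≤ j → j ≤ n → X j ω' = X j ω :=
  ⟨fun h j h1 hn => h j h1 h1 hn, fun h j h1 _ hn => h j h1 hn⟩

theorem hist_one_succ_iff {Ω α : Type*} (X : ℕ → Ω → α) (n : ℕ) (ω ω' : Ω) :
    hist X 1 (n + 1) ω ω' ↔ X (n + 1) ω' = X (n + 1) ω ∧ hist X 1 n ω ω' := by
  simp only [hist_one_iff]
  refine ⟨fun h => ⟨h _ (by omega) le_rfl, fun j h1 hn => h j h1 (by omega)⟩, ?_⟩
  rintro ⟨h, h'⟩ j h1 hn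
  rcases Nat.le_succ_iff.1 hn with hj | rfl
  exacts [h' j h1 hj, h]

/-- A conditional law given the joint past that depends only on the present also holds given
the present of `X` and the past of `Y`. -/
theorem prob_and_hist_eq_mul {Ω 𝒳 𝒴 : Type*} [Fintype Ω] {P : Ω → ℝ} (hP : ∀ ω, 0 ≤ P ω)
    (X : ℕ → Ω → 𝒳) (Y : ℕ → Ω → 𝒴) {n : ℕ} (hn : 1 ≤ n) (A : Ω → Prop) (k : ℝ) (x : 𝒳) (ω₀ : Ω)
    (h : ∀ ω, X n ω = x → Y n ω = Y n ω₀ →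
      0 < prob P (fun ω' => hist X 1 n ω ω' ∧ hist Y 1 n ω ω') →
      cprob P A (fun ω' => hist X 1 n ω ω' ∧ hist Y 1 n ω ω') = k) :
    prob P (fun ω => A ω ∧ X n ω = x ∧ hist Y 1 n ω₀ ω)
      = k * prob P (fun ω => X n ω = x ∧ hist Y 1 n ω₀ ω) := by
  let f : Ω → Set.Icc 1 n → 𝒳 × 𝒴 := fun ω j => (X j ω, Y j ω)
  have hf : ∀ ω ω', f ω' = f ω ↔ hist X 1 n ω ω' ∧ hist Y 1 n ω ω' := fun ω ω' => by
    simp only [f, funext_iff, Prod.mk.injEq, Subtype.forall, Set.mem_Icc, hist_one_iff]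
    exact ⟨fun h => ⟨fun j h1 h2 => (h j ⟨h1, h2⟩).1, fun j h1 h2 => (h j ⟨h1, h2⟩).2⟩,
      fun h j hj => ⟨h.1 j hj.1 hj.2, h.2 j hj.1 hj.2⟩⟩
  refine prob_and_eq_mul_of_fibers f (fun ω ω' e => ?_) fun ω hω => ?_
  · obtain ⟨hX, hY⟩ := (hf ω ω').1 e
    simp only [hist_one_iff] at hX hY ⊢
    exact fun hC => ⟨(hX n hn le_rfl).trans hC.1,
      fun j h1 h2 => (hY j h1 h2).trans (hC.2 j h1 h2)⟩
  · simp only [hf]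
    rw [← cprob_mul_prob hP]
    rcases (prob_nonneg hP (fun ω' => hist X 1 n ω ω' ∧ hist Y 1 n ω ω')).eq_or_lt with h0 | h0
    · rw [← h0, mul_zero, mul_zero]
    · rw [h ω hω.1 ((hist_one_iff Y n ω₀ ω).1 hω.2 n hn le_rfl) h0]

/-- Generalized HMM filter recursions for computing the restricted
distribution. For `(X, Y)` jointly first-order Markov with no instantaneous influences,
for every `i ≥ 2` and positive-probability history `y^i`:
(a) `P(Y_{i+1} = y ∣ y^i) = ∑_x P(Y_{i+1} = y ∣ X_i = x, Y_i = y_i) P(X_i = x ∣ y^i)`;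
(b) `P(X_i = x ∣ y^i) = ∑_{x'} P(X_i = x ∣ X_{i-1} = x', Y_{i-1} = y_{i-1}) P(X_{i-1} = x' ∣ y^i)`;
(c) Bayes update:
`P(X_{i-1} = x ∣ y^i) = P(Y_i = y_i ∣ X_{i-1} = x, Y_{i-1} = y_{i-1}) P(X_{i-1} = x ∣ y^{i-1}) / ∑_{x'} (…)`. -/
theorem hmm_filter_recursions
    {Ω 𝒳 𝒴 : Type*} [Fintype Ω] [Fintype 𝒳] [Fintype 𝒴]
    (P : Ω → ℝ) (hP : ∀ ω, 0 ≤ P ω) (hPsum : ∑ ω, P ω = 1)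
    (X : ℕ → Ω → 𝒳) (Y : ℕ → Ω → 𝒴)
    -- jointly first-order Markov
    (hMarkov : ∀ i ω, 2 ≤ i →
      0 < prob P (fun ω' => hist X 1 (i - 1) ω ω' ∧ hist Y 1 (i - 1) ω ω') →
      ∀ a b,
        cprob P (fun ω' => X i ω' = a ∧ Y i ω' = b)
            (fun ω' => hist X 1 (i - 1) ω ω' ∧ hist Y 1 (i - 1) ω ω')
          = cprob P (fun ω' => X i ω' = a ∧ Y i ω' = b)
            (fun ω' => X (i - 1) ω' = X (i - 1) ω ∧ Y (i - 1) ω' = Y (i - 1) ω))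
    -- no instantaneous influences
    (hNoInst : ∀ i ω, 2 ≤ i →
      0 < prob P (fun ω' => hist X 1 (i - 1) ω ω' ∧ hist Y 1 (i - 1) ω ω') →
      ∀ a b,
        cprob P (fun ω' => X i ω' = a ∧ Y i ω' = b)
            (fun ω' => hist X 1 (i - 1) ω ω' ∧ hist Y 1 (i - 1) ω ω')
          = cprob P (fun ω' => X i ω' = a)
              (fun ω' => hist X 1 (i - 1) ω ω' ∧ hist Y 1 (i - 1) ω ω') *
            cprob P (fun ω' => Y i ω' = b)
              (fun ω' => hist X 1 (i - 1) ω ω' ∧ hist Y 1 (i - 1) ω ω')) :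
    ∀ i ω, 2 ≤ i → 0 < prob P (hist Y 1 i ω) →
      -- (a) likelihood decomposition
      (∀ y : 𝒴,
        cprob P (fun ω' => Y (i + 1) ω' = y) (hist Y 1 i ω)
          = ∑ x, cprob P (fun ω' => Y (i + 1) ω' = y)
                (fun ω' => X i ω' = x ∧ Y i ω' = Y i ω) *
              cprob P (fun ω' => X i ω' = x) (hist Y 1 i ω)) ∧
      -- (b) prior decomposition
      (∀ x : 𝒳,
        cprob P (fun ω' => X i ω' = x) (hist Y 1 i ω)
          = ∑ x', cprob P (fun ω' => X i ω' = x)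
                (fun ω' => X (i - 1) ω' = x' ∧ Y (i - 1) ω' = Y (i - 1) ω) *
              cprob P (fun ω' => X (i - 1) ω' = x') (hist Y 1 i ω)) ∧
      -- (c) Bayes posterior update
      (∀ x : 𝒳,
        cprob P (fun ω' => X (i - 1) ω' = x) (hist Y 1 i ω)
          = cprob P (fun ω' => Y i ω' = Y i ω)
                (fun ω' => X (i - 1) ω' = x ∧ Y (i - 1) ω' = Y (i - 1) ω) *
              cprob P (fun ω' => X (i - 1) ω' = x) (hist Y 1 (i - 1) ω) /
            ∑ x', cprob P (fun ω' => Y i ω' = Y i ω)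
                (fun ω' => X (i - 1) ω' = x' ∧ Y (i - 1) ω' = Y (i - 1) ω) *
              cprob P (fun ω' => X (i - 1) ω' = x') (hist Y 1 (i - 1) ω)) := by
  have hMX : ∀ n ω, 1 ≤ n →
      0 < prob P (fun ω' => hist X 1 n ω ω' ∧ hist Y 1 n ω ω') → ∀ a,
      cprob P (fun ω' => X (n + 1) ω' = a) (fun ω' => hist X 1 n ω ω' ∧ hist Y 1 n ω ω')
        = cprob P (fun ω' => X (n + 1) ω' = a) (fun ω' => X n ω' = X n ω ∧ Y n ω' = Y n ω) := by
    intro n ω hn hpos a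
    rw [cprob_eq_sum (Y (n + 1)), cprob_eq_sum (Y (n + 1))]
    refine Finset.sum_congr rfl fun b _ => ?_
    simpa only [and_comm (a := Y (n + 1) _ = b), Nat.add_sub_cancel]
      using hMarkov (n + 1) ω (by omega) hpos a b
  have hMY : ∀ n ω, 1 ≤ n →
      0 < prob P (fun ω' => hist X 1 n ω ω' ∧ hist Y 1 n ω ω') → ∀ b,
      cprob P (fun ω' => Y (n + 1) ω' = b) (fun ω' => hist X 1 n ω ω' ∧ hist Y 1 n ω ω')
        = cprob P (fun ω' => Y (n + 1) ω' = b) (fun ω' => X n ω' = X n ω ∧ Y n ω' = Y n ω) := by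
    intro n ω hn hpos b
    rw [cprob_eq_sum (X (n + 1)), cprob_eq_sum (X (n + 1))]
    exact Finset.sum_congr rfl fun a _ => hMarkov (n + 1) ω (by omega) hpos a b
  have hY : ∀ n ω, 1 ≤ n → ∀ x b,
      prob P (fun ω' => Y (n + 1) ω' = b ∧ X n ω' = x ∧ hist Y 1 n ω ω')
        = cprob P (fun ω' => Y (n + 1) ω' = b) (fun ω' => X n ω' = x ∧ Y n ω' = Y n ω) *
          prob P (fun ω' => X n ω' = x ∧ hist Y 1 n ω ω') := fun n ω hn x b =>
    prob_and_hist_eq_mul hP X Y hn _ _ x ω fun ω' hx hy hpos => by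
      rw [hMY n ω' hn hpos, hx, hy]
  have hXY : ∀ n ω, 1 ≤ n → ∀ x a b,
      prob P (fun ω' => (X (n + 1) ω' = a ∧ Y (n + 1) ω' = b) ∧ X n ω' = x ∧ hist Y 1 n ω ω')
        = cprob P (fun ω' => X (n + 1) ω' = a) (fun ω' => X n ω' = x ∧ Y n ω' = Y n ω) *
          cprob P (fun ω' => Y (n + 1) ω' = b) (fun ω' => X n ω' = x ∧ Y n ω' = Y n ω) *
          prob P (fun ω' => X n ω' = x ∧ hist Y 1 n ω ω') := fun n ω hn x a b =>
    prob_and_hist_eq_mul hP X Y hn _ _ x ω fun ω' hx hy hpos => by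
      rw [← hx, ← hy, ← hMX n ω' hn hpos, ← hMY n ω' hn hpos]
      exact hNoInst (n + 1) ω' (by omega) hpos a b
  intro i ω hi hpos
  obtain ⟨n, rfl⟩ : ∃ n, i = n + 1 := ⟨i - 1, by omega⟩
  have hn : 1 ≤ n := by omega
  simp only [Nat.add_sub_cancel]
  have hsplit : ∀ x, prob P (fun ω' => X n ω' = x ∧ hist Y 1 (n + 1) ω ω')
      = cprob P (fun ω' => Y (n + 1) ω' = Y (n + 1) ω)
          (fun ω' => X n ω' = x ∧ Y n ω' = Y n ω) *
        prob P (fun ω' => X n ω' = x ∧ hist Y 1 n ω ω') := fun x => by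
    rw [← hY n ω hn x]
    exact prob_congr fun ω' => by rw [hist_one_succ_iff, and_left_comm]
  refine ⟨fun y => cprob_eq_sum_mul_cprob (X (n + 1)) fun x => hY (n + 1) ω (by omega) x y,
    fun x => cprob_eq_sum_mul_cprob (X n) fun x' => ?_, fun x => ?_⟩
  · rw [hsplit, ← mul_assoc, ← hXY n ω hn]
    exact prob_congr fun ω' => by rw [hist_one_succ_iff]; tauto
  · have hpast : prob P (hist Y 1 n ω) ≠ 0 := fun h0 =>
      hpos.ne' (prob_eq_zero_of_imp hP (fun ω' h => ((hist_one_succ_iff Y n ω ω').1 h).2) h0)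
    unfold cprob at hsplit ⊢
    simp only [← mul_div_assoc, ← hsplit]
    rw [← Finset.sum_div, ← prob_eq_sum (X n), div_div_div_cancel_right₀ hpast]

end
end
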